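/- There is an absolute constant c > 0 such that the following holds. Let k ≥ 1, let F be a family of closed disks of radius 1 in ℝ² such that every point of ℝ² lies in at most k of the disks (ply at most k), let A ⊆ F, and for each R ∈ A choose a point p_R ∈ R; let F ⊙ A denote the family obtained from F by replacing each R ∈ A with the point region {p_R}. Let S be a vertical slab of width 2 and let F' = { R ∈ F ⊙ A : R ⊆ S }. Then the upper quarter outer convex hull OCH(F') has at most c·k edges; in particular, at most c·k distinct regions of F' appear on OCH(F'). -/

import Mathlib

open scoped Classical
open Pointwise Set Metric

noncomputable section

/-- The plane ℝ². -/
abbrev Plane : Type := EuclideanSpace ℝ (Fin 2)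

/-- The closed convex cone C = {(x, y) : y ≤ −|x|} generated by (−1,−1) and (1,−1). -/
def quarterCone : Set Plane := {p : Plane | p 1 ≤ -|p 0|}

/-- Upper quarter convex hull of a set of points: the frontier of convexHull(S) + C. -/
def CHpts (S : Set Plane) : Set Plane := frontier (convexHull ℝ S + quarterCone)

/-- Upper quarter outer convex hull of a family of regions. -/
def OCH {n : ℕ} (F : Fin n → Set Plane) : Set Plane :=
  frontier (convexHull ℝ (⋃ i, F i) + quarterCone)

/-- A point region is a singleton. -/
def IsPointRegion (R : Set Plane) : Prop := ∃ p : Plane, R = {p}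

/-- A region is either a point region, or a compact connected set equal to the
closure of its nonempty interior. -/
def IsRegion (R : Set Plane) : Prop :=
  IsPointRegion R ∨
    (IsCompact R ∧ IsConnected R ∧ (interior R).Nonempty ∧ R = closure (interior R))

/-- A family of regions. -/
def RegionFamily {n : ℕ} (F : Fin n → Set Plane) : Prop := ∀ i, IsRegion (F i)

/-- The partial order ≺_P on indices induced by the left-to-right traversal of CH(P). -/
def precOrder {n : ℕ} (P : Fin n → Plane) (a b : Fin n) : Prop :=
  P a ∈ CHpts (Set.range P) ∧ P b ∈ CHpts (Set.range P) ∧ P a 0 < P b 0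

/-- A family is finished if all realisations induce the same partial order. -/
def Finished {n : ℕ} (F : Fin n → Set Plane) : Prop :=
  ∀ P₁ P₂ : Fin n → Plane, (∀ i, P₁ i ∈ F i) → (∀ i, P₂ i ∈ F i) →
    precOrder P₁ = precOrder P₂

/-- X is a witness: for every choice of points q_i ∈ R_i for regions outside X,
replacing each region outside X by the corresponding point yields an unfinished family. -/
def IsWitness {n : ℕ} (F : Fin n → Set Plane) (X : Set (Fin n)) : Prop :=
  ∀ q : Fin n → Plane, (∀ i, i ∉ X → q i ∈ F i) →
    ¬ Finished (fun i => if i ∈ X then F i else {q i})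

/-- p is a vertex of R: p lies on the frontier of R and every (nondegenerate) open
segment containing p contains a point off the frontier of R. -/
def IsVertex (R : Set Plane) (p : Plane) : Prop :=
  p ∈ frontier R ∧ ∀ q r : Plane, q ≠ r → p ∈ openSegment ℝ q r →
    ∃ z ∈ openSegment ℝ q r, z ∉ frontier R

/-- p is a vertex of some region of the family F. -/
def FamVertex {n : ℕ} (F : Fin n → Set Plane) (p : Plane) : Prop := ∃ i, IsVertex (F i) p

/-- (s, t) is an edge of OCH(F): distinct vertices of V(F), the closed segment [s,t]
lies on OCH(F), and its relative interior contains no point of V(F). -/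
def IsEdge {n : ℕ} (F : Fin n → Set Plane) (s t : Plane) : Prop :=
  s ≠ t ∧ FamVertex F s ∧ FamVertex F t ∧ segment ℝ s t ⊆ OCH F ∧
    ∀ p ∈ openSegment ℝ s t, ¬ FamVertex F p

/-- Two regions are strictly vertically separated. -/
def VertSep (R₁ R₂ : Set Plane) : Prop :=
  ∃ x₀ : ℝ, ((∀ p ∈ R₁, p 0 < x₀) ∧ (∀ p ∈ R₂, x₀ < p 0)) ∨
            ((∀ p ∈ R₂, p 0 < x₀) ∧ (∀ p ∈ R₁, x₀ < p 0))

/-- A vertex x is canonical in F: it is exclusively a vertex of point regions, or a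
vertex of exactly one non-point region. -/
def CanonicalVertex {n : ℕ} (F : Fin n → Set Plane) (x : Plane) : Prop :=
  (∀ i, IsVertex (F i) x → IsPointRegion (F i)) ∨
    (∃! i, IsVertex (F i) x ∧ ¬ IsPointRegion (F i))

/-- The pair (s, t) is canonical in F. -/
def CanonicalPair {n : ℕ} (F : Fin n → Set Plane) (s t : Plane) : Prop :=
  CanonicalVertex F s ∧ CanonicalVertex F t

/-- band(R₁, R₂) = convexHull(R₁ ∪ R₂). -/
def band (R₁ R₂ : Set Plane) : Set Plane := convexHull ℝ (R₁ ∪ R₂)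

/-- (s, t) with s ∈ V(R_a), t ∈ V(R_b) is dividing: canonical, and a = b or the two
regions are strictly vertically separated. -/
def DividingPair {n : ℕ} (F : Fin n → Set Plane) (a b : Fin n) (s t : Plane) : Prop :=
  IsVertex (F a) s ∧ IsVertex (F b) t ∧ CanonicalPair F s t ∧
    (a = b ∨ VertSep (F a) (F b))

/-- (s, t) is dividing for some pair of regions. -/
def DividingEdge {n : ℕ} (F : Fin n → Set Plane) (s t : Plane) : Prop :=
  ∃ a b, DividingPair F a b s t

/-- (s, t) is occupied: dividing, and band(R_a, R_b) contains a vertex of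
V(F − R_a − R_b) other than s and t. -/
def OccupiedEdge {n : ℕ} (F : Fin n → Set Plane) (s t : Plane) : Prop :=
  ∃ a b, DividingPair F a b s t ∧
    ∃ i, i ≠ a ∧ i ≠ b ∧ ∃ q, IsVertex (F i) q ∧ q ∈ band (F a) (F b) ∧ q ≠ s ∧ q ≠ t

/-- A contiguous subchain w = (q, r, …, s, t) of OCH(F) (of m ≥ 2 edges) that is
spanning in F for the regions (R_a, R_b, R_c). -/
def SpanningSubchain {n : ℕ} (F : Fin n → Set Plane) (m : ℕ) (w : Fin (m + 1) → Plane)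
    (a b c : Fin n) : Prop :=
  2 ≤ m ∧
  (∀ j : Fin m, IsEdge F (w j.castSucc) (w j.succ)) ∧
  (∀ j : Fin m, DividingEdge F (w j.castSucc) (w j.succ)) ∧
  IsVertex (F a) (w 0) ∧ IsVertex (F c) (w (Fin.last m)) ∧
  (∀ j : Fin (m + 1), 1 ≤ (j : ℕ) → (j : ℕ) ≤ m - 1 → IsVertex (F b) (w j)) ∧
  (F b ∩ interior (convexHull ℝ (F a ∪ F c) + quarterCone)).Nonempty

/-- F is terminal: every edge of OCH(F) is dividing, no edge is occupied, and no
contiguous subchain of OCH(F) is spanning. -/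
def Terminal {n : ℕ} (F : Fin n → Set Plane) : Prop :=
  (∀ s t, IsEdge F s t → DividingEdge F s t) ∧
  (∀ s t, IsEdge F s t → ¬ OccupiedEdge F s t) ∧
  ¬ ∃ (m : ℕ) (w : Fin (m + 1) → Plane) (a b c : Fin n), SpanningSubchain F m w a b c

/-- A region appears on OCH(F) if some point of it lies on OCH(F). -/
def Appears {n : ℕ} (F : Fin n → Set Plane) (R : Set Plane) : Prop :=
  ∃ p ∈ R, p ∈ OCH F

/-- Upper quarter outer convex hull of the subfamily of G indexed by I. -/
def OCHOn {n : ℕ} (G : Fin n → Set Plane) (I : Set (Fin n)) : Set Plane :=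
  frontier (convexHull ℝ (⋃ i ∈ I, G i) + quarterCone)

/-- p is a vertex of some region of the subfamily of G indexed by I. -/
def FamVertexOn {n : ℕ} (G : Fin n → Set Plane) (I : Set (Fin n)) (p : Plane) : Prop :=
  ∃ i ∈ I, IsVertex (G i) p

/-- (s, t) is an edge of the outer hull of the subfamily of G indexed by I. -/
def IsEdgeOn {n : ℕ} (G : Fin n → Set Plane) (I : Set (Fin n)) (s t : Plane) : Prop :=
  s ≠ t ∧ FamVertexOn G I s ∧ FamVertexOn G I t ∧ segment ℝ s t ⊆ OCHOn G I ∧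
    ∀ p ∈ openSegment ℝ s t, ¬ FamVertexOn G I p

/-- A region appears on the outer hull of the subfamily of G indexed by I. -/
def AppearsOn {n : ℕ} (G : Fin n → Set Plane) (I : Set (Fin n)) (R : Set Plane) : Prop :=
  ∃ p ∈ R, p ∈ OCHOn G I

/-- The open cone {(x, y) : y < −|x|}, the interior of the quarter cone. -/
def openQuarterCone : Set Plane := {p : Plane | p 1 < -|p 0|}

lemma isOpen_openQuarterCone : IsOpen openQuarterCone := by
  unfold openQuarterCone
  exact isOpen_lt (by fun_prop) (by fun_prop)

lemma quarterCone_add_openQuarterCone_subset :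
    quarterCone + openQuarterCone ⊆ quarterCone := by
  rintro _ ⟨a, ha, b, hb, rfl⟩
  simp only [quarterCone, openQuarterCone, mem_ofPred_eq, PiLp.add_apply] at *
  linarith [abs_add_le (a 0) (b 0)]

lemma subset_add_quarterCone (S : Set Plane) : S ⊆ S + quarterCone := fun x hx =>
  ⟨x, hx, 0, by simp [quarterCone], by simp⟩

lemma add_mem_interior_add_quarterCone {S : Set Plane} {p u : Plane}
    (hp : p ∈ closure (S + quarterCone)) (hu : u ∈ openQuarterCone) :
    p + u ∈ interior (S + quarterCone) := by
  have hopen : IsOpen ((S + quarterCone) + openQuarterCone) := isOpen_openQuarterCone.add_left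
  have hsub : (S + quarterCone) + openQuarterCone ⊆ S + quarterCone := by
    rw [add_assoc]
    exact add_subset_add_left quarterCone_add_openQuarterCone_subset
  refine interior_maximal hsub hopen ?_
  rw [← isOpen_openQuarterCone.closure_add]
  exact add_mem_add hp hu

/-- The upper quarter hull boundary is the graph of a 1-Lipschitz function. -/
lemma abs_sub_le_of_mem_frontier {S : Set Plane} {p q : Plane}
    (hp : p ∈ frontier (S + quarterCone)) (hq : q ∈ frontier (S + quarterCone)) :
    |p 1 - q 1| ≤ |p 0 - q 0| := by
  have key : ∀ a b : Plane, a ∈ frontier (S + quarterCone) → b ∈ frontier (S + quarterCone) →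
      a 1 - b 1 ≤ |a 0 - b 0| := by
    intro a b ha hb
    by_contra! h
    have hu : b - a ∈ openQuarterCone := by
      simp only [openQuarterCone, mem_ofPred_eq, PiLp.sub_apply]
      rw [abs_sub_comm]
      linarith
    have := add_mem_interior_add_quarterCone ha.1 hu
    rw [add_sub_cancel] at this
    exact hb.2 this
  rw [abs_le]
  have h1 := key p q hp hq
  have h2 := key q p hq hp
  rw [abs_sub_comm] at h2
  exact ⟨by linarith, h1⟩

lemma eq_of_mem_frontier_of_fst_eq {S : Set Plane} {p q : Plane}
    (hp : p ∈ frontier (S + quarterCone)) (hq : q ∈ frontier (S + quarterCone))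
    (h : p 0 = q 0) : p = q := by
  have := abs_sub_le_of_mem_frontier hp hq
  rw [h, sub_self, abs_zero] at this
  have h1 : p 1 = q 1 := sub_eq_zero.1 (abs_nonpos_iff.1 this)
  ext i
  fin_cases i
  · exact h
  · exact h1

/-- A point of the hull boundary whose abscissa lies strictly between those of the ends of a
segment of the boundary lies on that segment. -/
lemma mem_openSegment_of_mem_frontier {S : Set Plane} {s t q : Plane}
    (hseg : segment ℝ s t ⊆ frontier (S + quarterCone)) (hq : q ∈ frontier (S + quarterCone))
    (h : q 0 ∈ openSegment ℝ (s 0) (t 0)) : q ∈ openSegment ℝ s t := by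
  obtain ⟨a, b, ha, hb, hab, he⟩ := h
  have hm : a • s + b • t ∈ openSegment ℝ s t := ⟨a, b, ha, hb, hab, rfl⟩
  have : a • s + b • t = q := by
    apply eq_of_mem_frontier_of_fst_eq (hseg (openSegment_subset_segment _ _ _ hm)) hq
    simpa using he
  rwa [this] at hm

lemma IsVertex.mem_of_isClosed {R : Set Plane} {p : Plane} (h : IsVertex R p)
    (hR : IsClosed R) : p ∈ R := hR.frontier_subset h.1

lemma IsEdgeOn.symm {n : ℕ} {G : Fin n → Set Plane} {I : Set (Fin n)} {s t : Plane}
    (h : IsEdgeOn G I s t) : IsEdgeOn G I t s := by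
  obtain ⟨h1, h2, h3, h4, h5⟩ := h
  exact ⟨h1.symm, h3, h2, by rwa [segment_symm], by rwa [openSegment_symm]⟩

lemma IsEdgeOn.fst_ne {n : ℕ} {G : Fin n → Set Plane} {I : Set (Fin n)} {s t : Plane}
    (h : IsEdgeOn G I s t) : s 0 ≠ t 0 := fun he =>
  h.1 (eq_of_mem_frontier_of_fst_eq (h.2.2.2.1 (left_mem_segment _ _ _))
    (h.2.2.2.1 (right_mem_segment _ _ _)) he)

/-- On each side, a vertex is the end of at most one edge. -/
lemma IsEdgeOn.unique {n : ℕ} {G : Fin n → Set Plane} {I : Set (Fin n)} {s t t' : Plane}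
    (h : IsEdgeOn G I s t) (h' : IsEdgeOn G I s t') (hside : s 0 < t 0 ↔ s 0 < t' 0) :
    t = t' := by
  have ht := h.2.2.2.1 (right_mem_segment _ _ _)
  have ht' := h'.2.2.2.1 (right_mem_segment _ _ _)
  have hn : t 0 ∉ openSegment ℝ (s 0) (t' 0) := fun hm =>
    h'.2.2.2.2 t (mem_openSegment_of_mem_frontier h'.2.2.2.1 ht hm) h.2.2.1
  have hn' : t' 0 ∉ openSegment ℝ (s 0) (t 0) := fun hm =>
    h.2.2.2.2 t' (mem_openSegment_of_mem_frontier h.2.2.2.1 ht' hm) h'.2.2.1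
  refine eq_of_mem_frontier_of_fst_eq ht ht' ?_
  have h1 := h.fst_ne
  have h2 := h'.fst_ne
  rcases lt_or_gt_of_ne h1 with hs | hs
  · have hs' := hside.1 hs
    rw [openSegment_eq_Ioo hs', mem_Ioo] at hn
    rw [openSegment_eq_Ioo hs, mem_Ioo] at hn'
    push Not at hn hn'
    exact le_antisymm (hn' hs') (hn hs)
  · have hs' : t' 0 < s 0 := lt_of_le_of_ne (not_lt.1 fun hl => hs.not_gt (hside.2 hl)) h2.symm
    rw [openSegment_symm, openSegment_eq_Ioo hs', mem_Ioo] at hn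
    rw [openSegment_symm, openSegment_eq_Ioo hs, mem_Ioo] at hn'
    by_contra hne
    rcases lt_or_gt_of_ne hne with hl | hl
    · exact hn' ⟨hl, hs'⟩
    · exact hn ⟨hl, hs⟩

/-- If every edge ends at a point region, there are at most four times as many ordered edges as
regions on the hull. -/
lemma ncard_edges_le {n : ℕ} {G : Fin n → Set Plane} {I : Set (Fin n)}
    (hpt : ∀ s t, IsEdgeOn G I s t → (∃ i ∈ I, G i = {s}) ∨ (∃ i ∈ I, G i = {t})) :
    Set.ncard {e : Plane × Plane | IsEdgeOn G I e.1 e.2} ≤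
      4 * Set.ncard {i ∈ I | AppearsOn G I (G i)} := by
  set J := {i ∈ I | AppearsOn G I (G i)}
  have hch : ∀ e : Plane × Plane, IsEdgeOn G I e.1 e.2 → ∃ x : Fin n × (Bool × Bool),
      x.1 ∈ J ∧ G x.1 = {if x.2.1 then e.1 else e.2} ∧ (x.2.2 = true ↔ e.1 0 < e.2 0) := by
    rintro ⟨s, t⟩ h
    rcases hpt s t h with ⟨i, hi, hG⟩ | ⟨i, hi, hG⟩
    · refine ⟨(i, true, decide (s 0 < t 0)), ⟨hi, s, by simp [hG], ?_⟩, by simp [hG], by simp⟩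
      exact h.2.2.2.1 (left_mem_segment _ _ _)
    · refine ⟨(i, false, decide (s 0 < t 0)), ⟨hi, t, by simp [hG], ?_⟩, by simp [hG], by simp⟩
      exact h.2.2.2.1 (right_mem_segment _ _ _)
  rcases Set.eq_empty_or_nonempty {e : Plane × Plane | IsEdgeOn G I e.1 e.2} with hemp | ⟨e, he⟩
  · rw [hemp, ncard_empty]
    exact Nat.zero_le _
  have : Nonempty (Fin n × (Bool × Bool)) := ⟨(hch e he).choose⟩
  choose! f hf using hch
  have hcard : (J ×ˢ (univ : Set (Bool × Bool))).ncard = 4 * J.ncard := by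
    rw [Set.ncard_prod, Set.ncard_univ, Nat.card_eq_fintype_card]
    simp [mul_comm]
  rw [← hcard]
  refine Set.ncard_le_ncard_of_injOn f (fun e he => ⟨(hf e he).1, mem_univ _⟩) ?_ (Set.toFinite _)
  rintro ⟨s, t⟩ he ⟨s', t'⟩ he' hff
  obtain ⟨-, h1, h2⟩ := hf _ he
  obtain ⟨-, h1', h2'⟩ := hf _ he'
  rw [← hff] at h1' h2'
  have hpts := Set.singleton_injective (h1.symm.trans h1')
  have hside := h2.symm.trans h2'
  simp only [mem_ofPred_eq] at he he' hside
  cases hb : (f (s, t)).2.1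
  · simp only [hb, Bool.false_eq_true, if_false] at hpts
    subst hpts
    have : s = s' := by
      refine he.symm.unique he'.symm ?_
      have a := he.fst_ne
      have b := he'.fst_ne
      rw [← not_iff_not, not_lt, not_lt, a.le_iff_lt, b.le_iff_lt]
      exact hside
    rw [this]
  · simp only [hb, if_true] at hpts
    subst hpts
    rw [he.unique he' hside]

lemma mem_closedBall_one_iff_sq (z q : Plane) :
    q ∈ closedBall z 1 ↔ (q 0 - z 0) ^ 2 + (q 1 - z 1) ^ 2 ≤ 1 := by
  rw [mem_closedBall, EuclideanSpace.dist_eq, Real.sqrt_le_one, Fin.sum_univ_two,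
    Real.dist_eq, Real.dist_eq, sq_abs, sq_abs]

lemma abs_sub_le_of_mem_closedBall_one {z q : Plane} (h : q ∈ closedBall z 1) :
    |z 0 - q 0| ≤ 1 ∧ |z 1 - q 1| ≤ 1 := by
  rw [mem_closedBall_one_iff_sq] at h
  exact ⟨abs_le_of_sq_le_sq (by nlinarith [sq_nonneg (q 1 - z 1)]) zero_le_one,
    abs_le_of_sq_le_sq (by nlinarith [sq_nonneg (q 0 - z 0)]) zero_le_one⟩

/-- A unit disk inside a vertical slab of width 2 is centred on the midline. -/
lemma fst_eq_of_closedBall_subset_slab {z : Plane} {x₀ : ℝ}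
    (h : closedBall z 1 ⊆ {q : Plane | x₀ ≤ q 0 ∧ q 0 ≤ x₀ + 2}) : z 0 = x₀ + 1 := by
  have h1 := (h (show !₂[z 0 - 1, z 1] ∈ closedBall z 1 by
    rw [mem_closedBall_one_iff_sq]; norm_num)).1
  have h2 := (h (show !₂[z 0 + 1, z 1] ∈ closedBall z 1 by
    rw [mem_closedBall_one_iff_sq]; norm_num)).2
  norm_num at h1 h2
  linarith

/-- Of two vertically aligned unit disks, the strictly lower one misses the hull boundary. -/
lemma snd_le_of_mem_frontier {S : Set Plane} {z w s : Plane} (hw : closedBall w 1 ⊆ S)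
    (hx : z 0 = w 0) (hs : s ∈ closedBall z 1) (hf : s ∈ frontier (S + quarterCone)) :
    w 1 ≤ z 1 := by
  by_contra! hlt
  have hmem : s + (w - z) ∈ closedBall w 1 := by
    rw [mem_closedBall_one_iff_sq] at hs ⊢
    simp only [PiLp.add_apply, PiLp.sub_apply]
    convert hs using 2 <;> ring
  have hu : z - w ∈ openQuarterCone := by
    simp only [openQuarterCone, mem_ofPred_eq, PiLp.sub_apply, hx, sub_self, abs_zero, neg_zero]
    linarith
  have := add_mem_interior_add_quarterCone
    (subset_closure (subset_add_quarterCone S (hw hmem))) hu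
  rw [show s + (w - z) + (z - w) = s by abel] at this
  exact hf.2 this

/-- No segment of the hull boundary joins points of two vertically aligned unit disks. -/
lemma not_segment_subset_frontier {S : Set Plane} {z w s t : Plane}
    (hz : closedBall z 1 ⊆ S) (hw : closedBall w 1 ⊆ S) (hx : z 0 = w 0)
    (hs : s ∈ closedBall z 1) (ht : t ∈ closedBall w 1) (hst : s ≠ t) :
    ¬ segment ℝ s t ⊆ frontier (S + quarterCone) := by
  intro hseg
  have h1 := snd_le_of_mem_frontier hw hx hs (hseg (left_mem_segment _ _ _))
  have h2 := snd_le_of_mem_frontier hz hx.symm ht (hseg (right_mem_segment _ _ _))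
  have hzw : w = z := by
    ext i
    fin_cases i
    · exact hx.symm
    · exact le_antisymm h1 h2
  subst hzw
  have hm : midpoint ℝ s t ∈ openSegment ℝ s t := by
    rw [midpoint_eq_smul_add, smul_add]
    exact ⟨_, _, by norm_num, by norm_num, by norm_num, rfl⟩
  have hint := (strictConvex_closedBall ℝ w 1).openSegment_subset hs ht hst hm
  exact (hseg (openSegment_subset_segment _ _ _ hm)).2
    (interior_mono (hw.trans (subset_add_quarterCone S)) hint)

lemma exists_int_abs_sub_le_half {x : ℝ} (hx : |x| ≤ 3) :
    ∃ a ∈ Finset.Icc (-3 : ℤ) 3, |x - a| ≤ 1 / 2 := by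
  refine ⟨round x, ?_, abs_sub_round x⟩
  have h := abs_le.1 (abs_sub_round x)
  have hx := abs_le.1 hx
  have h1 : (-4 : ℤ) < round x := by
    have : (-4 : ℝ) < round x := by linarith
    exact_mod_cast this
  have h2 : round x < (4 : ℤ) := by
    have : (round x : ℝ) < 4 := by linarith
    exact_mod_cast this
  rw [Finset.mem_Icc]
  omega

/-- Unit disks of ply at most k have at most 49 k centres in a square of side 6. -/
lemma ncard_le_of_centers_mem_square {n : ℕ} {k : ℝ} {z : Fin n → Plane}
    (hply : ∀ q : Plane, (Set.ncard {i : Fin n | q ∈ closedBall (z i) 1} : ℝ) ≤ k)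
    {J : Set (Fin n)} (o : Plane) (hJ : ∀ i ∈ J, |z i 0 - o 0| ≤ 3 ∧ |z i 1 - o 1| ≤ 3) :
    (J.ncard : ℝ) ≤ 49 * k := by
  set T := Finset.Icc (-3 : ℤ) 3 ×ˢ Finset.Icc (-3 : ℤ) 3
  set B : ℤ × ℤ → Set (Fin n) := fun a =>
    {i | !₂[o 0 + a.1, o 1 + a.2] ∈ closedBall (z i) 1}
  have hcov : J ⊆ ⋃ a ∈ T, B a := by
    intro i hi
    obtain ⟨a, ha, ha'⟩ := exists_int_abs_sub_le_half (hJ i hi).1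
    obtain ⟨b, hb, hb'⟩ := exists_int_abs_sub_le_half (hJ i hi).2
    refine mem_biUnion (x := (a, b)) (Finset.mk_mem_product ha hb) ?_
    change _ ∈ closedBall (z i) 1
    rw [mem_closedBall_one_iff_sq]
    simp only [Matrix.cons_val_zero, Matrix.cons_val_one]
    rw [abs_le] at ha' hb'
    nlinarith
  have h1 : J.ncard ≤ ∑ a ∈ T, (B a).ncard :=
    (Set.ncard_le_ncard hcov (Set.toFinite _)).trans (Finset.set_ncard_biUnion_le T B)
  calc (J.ncard : ℝ) ≤ ∑ a ∈ T, ((B a).ncard : ℝ) := by exact_mod_cast h1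
    _ ≤ ∑ _a ∈ T, k := Finset.sum_le_sum fun a _ => hply _
    _ = 49 * k := by simp [T]

/-- hull complexity of unit disks of ply at most k (after arbitrary
retrievals) restricted to a vertical slab of width 2. -/
theorem hull_complexity_ply_disks :
    ∃ c : ℝ, 0 < c ∧
      ∀ (k : ℝ), 1 ≤ k →
      ∀ (n : ℕ) (z : Fin n → Plane),
        (∀ q : Plane, (Set.ncard {i : Fin n | q ∈ Metric.closedBall (z i) 1} : ℝ) ≤ k) →
      ∀ (A : Set (Fin n)) (p : Fin n → Plane),
        (∀ i ∈ A, p i ∈ Metric.closedBall (z i) 1) →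
      ∀ (x₀ : ℝ) (G : Fin n → Set Plane),
        G = (fun i => if i ∈ A then {p i} else Metric.closedBall (z i) 1) →
      ∀ I : Set (Fin n),
        I = {i | G i ⊆ {q : Plane | x₀ ≤ q 0 ∧ q 0 ≤ x₀ + 2}} →
        (Set.ncard {e : Plane × Plane | IsEdgeOn G I e.1 e.2} : ℝ) ≤ c * k ∧
        (Set.ncard {i ∈ I | AppearsOn G I (G i)} : ℝ) ≤ c * k := by
  refine ⟨196, by norm_num, ?_⟩
  intro k hk n z hply A p hp x₀ G hG I hI
  set J := {i ∈ I | AppearsOn G I (G i)}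
  have hGA : ∀ i ∈ A, G i = {p i} := fun i hi => by simp [hG, hi]
  have hGB : ∀ i ∉ A, G i = closedBall (z i) 1 := fun i hi => by simp [hG, hi]
  have hsub : ∀ i, G i ⊆ closedBall (z i) 1 := by
    intro i
    by_cases hi : i ∈ A
    · rw [hGA i hi]
      exact singleton_subset_iff.2 (hp i hi)
    · rw [hGB i hi]
  have hclosed : ∀ i, IsClosed (G i) := by
    intro i
    by_cases hi : i ∈ A
    · rw [hGA i hi]
      exact isClosed_singleton
    · rw [hGB i hi]
      exact isClosed_closedBall
  have hslab : ∀ i ∈ I, G i ⊆ {q : Plane | x₀ ≤ q 0 ∧ q 0 ≤ x₀ + 2} := fun i hi => by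
    rwa [hI] at hi
  have hhull : ∀ i ∈ I, G i ⊆ convexHull ℝ (⋃ i ∈ I, G i) := fun i hi =>
    (subset_biUnion_of_mem hi).trans (subset_convexHull ℝ _)
  have hJ : (J.ncard : ℝ) ≤ 49 * k := by
    rcases J.eq_empty_or_nonempty with hemp | ⟨j, hj, o, ho, hof⟩
    · rw [hemp, ncard_empty, Nat.cast_zero]
      linarith
    · refine ncard_le_of_centers_mem_square hply o ?_
      rintro i ⟨hi, q, hq, hqf⟩
      have h1 := abs_sub_le_of_mem_frontier hqf hof
      have h2 := hslab i hi hq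
      have h3 := hslab j hj ho
      have h4 : |q 0 - o 0| ≤ 2 := by
        rw [abs_le]
        constructor <;> linarith [h2.1, h2.2, h3.1, h3.2]
      obtain ⟨h5, h6⟩ := abs_sub_le_of_mem_closedBall_one (hsub i hq)
      constructor
      · linarith [abs_sub_le (z i 0) (q 0) (o 0)]
      · linarith [abs_sub_le (z i 1) (q 1) (o 1)]
  refine ⟨?_, by linarith⟩
  have hE : (Set.ncard {e : Plane × Plane | IsEdgeOn G I e.1 e.2} : ℝ) ≤ 4 * J.ncard := by
    refine mod_cast ncard_edges_le ?_
    rintro s t ⟨hst, ⟨i, hi, hs⟩, ⟨j, hj, ht⟩, hseg, -⟩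
    have hs := hs.mem_of_isClosed (hclosed i)
    have ht := ht.mem_of_isClosed (hclosed j)
    by_cases hiA : i ∈ A
    · refine .inl ⟨i, hi, ?_⟩
      rw [hGA i hiA] at hs ⊢
      rw [mem_singleton_iff.1 hs]
    by_cases hjA : j ∈ A
    · refine .inr ⟨j, hj, ?_⟩
      rw [hGA j hjA] at ht ⊢
      rw [mem_singleton_iff.1 ht]
    have hzi := hslab i hi
    have hzj := hslab j hj
    have hi' := hhull i hi
    have hj' := hhull j hj
    rw [hGB i hiA] at hs hzi hi'
    rw [hGB j hjA] at ht hzj hj'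
    exact absurd hseg (not_segment_subset_frontier hi' hj'
      ((fst_eq_of_closedBall_subset_slab hzi).trans
        (fst_eq_of_closedBall_subset_slab hzj).symm) hs ht hst)
  linarith
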